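/- arXiv:cs/0405076 — 4 statements merged into one kernel-verified Lean document; each statement's English description precedes it below -/
import Mathlib

section
/- Let ⟨P, A⟩ be an abductive program and G a ground literal (a positive observation). If (E, F) is a credulous explanation of G with respect to ⟨P, A⟩, then (E, F) is a skeptical explanation of G with respect to ⟨P, A⟩ if and only if the program (P \ F) ∪ E ∪ { ← G } is inconsistent. -/
namespace ASP

/-- A ground literal: an atom or its explicit (classical) negation. -/
inductive Lit (α : Type) where
  | pos : α → Lit α
  | neg : α → Lit α

/-- The complement ¬L of a literal L. -/
def Lit.compl {α : Type} : Lit α → Lit α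
  | .pos a => .neg a
  | .neg a => .pos a

/-- The atom of a literal. -/
def Lit.atom {α : Type} : Lit α → α
  | .pos a => a
  | .neg a => a

/-- Map a literal along a function on atoms. -/
def Lit.map {α β : Type} (f : α → β) : Lit α → Lit β
  | .pos a => .pos (f a)
  | .neg a => .neg (f a)

/-- A ground rule  Σ ← Γ, not Δ  with head Σ, positive body Γ, negative body Δ. -/
structure Rule (α : Type) where
  head : Finset (Lit α)
  pbody : Finset (Lit α)
  nbody : Finset (Lit α)

/-- An extended disjunctive program: a set of ground rules. -/
abbrev Program (α : Type) := Set (Rule α)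

/-- Map a rule along a function on atoms. -/
noncomputable def Rule.map {α β : Type} (f : α → β) (r : Rule α) : Rule β :=
  letI := Classical.decEq (Lit β)
  ⟨r.head.image (Lit.map f), r.pbody.image (Lit.map f), r.nbody.image (Lit.map f)⟩

/-- The set of atoms occurring in a rule. -/
def Rule.atoms {α : Type} (r : Rule α) : Set α :=
  Lit.atom '' ((↑r.head : Set (Lit α)) ∪ (↑r.pbody : Set (Lit α)) ∪ (↑r.nbody : Set (Lit α)))

/-- S satisfies the rule Σ ← Γ, not Δ : if Γ ⊆ S and Δ ∩ S = ∅ then Σ ∩ S ≠ ∅. -/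
def Rule.sat {α : Type} (S : Set (Lit α)) (r : Rule α) : Prop :=
  ((↑r.pbody : Set (Lit α)) ⊆ S ∧ ∀ l ∈ r.nbody, l ∉ S) → ∃ l ∈ r.head, l ∈ S

/-- The two closure conditions on candidate answer sets of a not-free program:
S satisfies every rule, and if S contains a complementary pair then S is the
set of all literals of the language. -/
def okNF {α : Type} (P : Program α) (S : Set (Lit α)) : Prop :=
  (∀ r ∈ P, r.sat S) ∧ ((∃ l : Lit α, l ∈ S ∧ l.compl ∈ S) → S = Set.univ)

/-- Answer set of a not-free program: a minimal set satisfying the conditions. -/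
def AnswerSetNF {α : Type} (P : Program α) (S : Set (Lit α)) : Prop :=
  okNF P S ∧ ∀ T, T ⊆ S → okNF P T → T = S

/-- The reduct P^S of a program P with respect to S. -/
def reduct {α : Type} (P : Program α) (S : Set (Lit α)) : Program α :=
  { r' | ∃ r ∈ P, (∀ l ∈ r.nbody, l ∉ S) ∧ r' = ⟨r.head, r.pbody, (∅ : Finset (Lit α))⟩ }

/-- S is an answer set of P if S is an answer set of the reduct P^S. -/
def AnswerSet {α : Type} (P : Program α) (S : Set (Lit α)) : Prop :=
  AnswerSetNF (reduct P S) S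

/-- S is a consistent answer set of P. -/
def ConsAS {α : Type} (P : Program α) (S : Set (Lit α)) : Prop :=
  AnswerSet P S ∧ S ≠ Set.univ

/-- P is consistent: it has a consistent answer set. -/
def Consistent {α : Type} (P : Program α) : Prop := ∃ S, ConsAS P S

/-- P ⊨ G : G belongs to every answer set of P. -/
def Entails {α : Type} (P : Program α) (G : Lit α) : Prop :=
  ∀ S, AnswerSet P S → G ∈ S

/-- The fact L ← . -/
def factOf {α : Type} (l : Lit α) : Rule α := ⟨{l}, ∅, ∅⟩

/-- A set of literals viewed as a program of facts. -/
def facts {α : Type} (A : Set (Lit α)) : Program α := factOf '' A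

/-- The updated program (P \ F) ∪ E. -/
def upd {α : Type} (P E F : Program α) : Program α := (P \ F) ∪ E

/-- Hypothesis condition for (anti-)explanations: E ⊆ A \ P and F ⊆ A ∩ P. -/
def Hyp {α : Type} (P A E F : Program α) : Prop := E ⊆ A \ P ∧ F ⊆ A ∩ P

/-- (E,F) is a credulous explanation of the positive observation G w.r.t. ⟨P,A⟩. -/
def CredExpl {α : Type} (P A : Program α) (G : Lit α) (E F : Program α) : Prop :=
  Hyp P A E F ∧ ∃ S, ConsAS (upd P E F) S ∧ G ∈ S

/-- (E,F) is a skeptical explanation of the positive observation G w.r.t. ⟨P,A⟩. -/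
def SkepExpl {α : Type} (P A : Program α) (G : Lit α) (E F : Program α) : Prop :=
  Hyp P A E F ∧ Consistent (upd P E F) ∧ Entails (upd P E F) G

/-- (E,F) is a credulous anti-explanation of the negative observation G w.r.t. ⟨P,A⟩. -/
def CredAntiExpl {α : Type} (P A : Program α) (G : Lit α) (E F : Program α) : Prop :=
  Hyp P A E F ∧ Consistent (upd P E F) ∧ ¬ Entails (upd P E F) G

/-- (E,F) is a skeptical anti-explanation of the negative observation G w.r.t. ⟨P,A⟩. -/
def SkepAntiExpl {α : Type} (P A : Program α) (G : Lit α) (E F : Program α) : Prop :=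
  Hyp P A E F ∧ Consistent (upd P E F) ∧ ∀ S, AnswerSet (upd P E F) S → G ∉ S

/-- (E,F) is a credulous anti-explanation of the negative observation ⊥ w.r.t. ⟨P,A⟩:
(P \ F) ∪ E is consistent. -/
def CredAntiExplBot {α : Type} (P A : Program α) (E F : Program α) : Prop :=
  Hyp P A E F ∧ Consistent (upd P E F)

/-- (E,F) is a minimal pair among those satisfying X. -/
def MinimalPair {α : Type} (X : Program α → Program α → Prop) (E F : Program α) : Prop :=
  X E F ∧ ∀ E' F', X E' F' → E' ⊆ E → F' ⊆ F → (E' = E ∧ F' = F)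

/-- Standing assumption on abductive programs: any rule of P whose head contains
an abducible has all its head literals abducible and an empty body. -/
def AbdAssum1 {α : Type} (P A : Program α) : Prop :=
  ∀ r ∈ P, (∃ l ∈ r.head, factOf l ∈ A) →
    ((∀ l ∈ r.head, factOf l ∈ A) ∧ r.pbody = ∅ ∧ r.nbody = ∅)

/-- Standing assumption on abductive programs: any (disjunctive) fact of P all of
whose disjuncts are abducibles itself belongs to A. -/
def AbdAssum2 {α : Type} (P A : Program α) : Prop :=
  ∀ r ∈ P, r.head ≠ ∅ → r.pbody = ∅ → r.nbody = ∅ →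
    (∀ l ∈ r.head, factOf l ∈ A) → r ∈ A

/-- Atoms of the update program: base atoms, the fresh atoms ā, +a, −a for abducibles a. -/
inductive UAtom (α : Type) where
  | base : α → UAtom α
  | abar : Lit α → UAtom α
  | aplus : Lit α → UAtom α
  | aminus : Lit α → UAtom α

/-- Embedding of literals over α into literals over UAtom α. -/
def emb {α : Type} : Lit α → Lit (UAtom α) := Lit.map UAtom.base

/-- The update program UP of an abductive program ⟨P, A⟩ with abducible facts A. -/
noncomputable def UP {α : Type} (P : Program α) (A : Set (Lit α)) : Program (UAtom α) :=
  (Rule.map UAtom.base '' (P \ facts A)) ∪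
  { r | ∃ a ∈ A, r = ⟨{emb a}, ∅, {Lit.pos (UAtom.abar a)}⟩ ∨
                 r = ⟨{Lit.pos (UAtom.abar a)}, ∅, {emb a}⟩ } ∪
  { r | ∃ a ∈ A, factOf a ∉ P ∧ r = ⟨{Lit.pos (UAtom.aplus a)}, {emb a}, ∅⟩ } ∪
  { r | ∃ a ∈ A, factOf a ∈ P ∧ r = ⟨{Lit.pos (UAtom.aminus a)}, ∅, {emb a}⟩ }

/-- E⁺ = { +a | a ∈ E }. -/
def pSet {α : Type} (E : Set (Lit α)) : Set (Lit (UAtom α)) :=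
  { l | ∃ a ∈ E, l = Lit.pos (UAtom.aplus a) }

/-- F⁻ = { −a | a ∈ F }. -/
def mSet {α : Type} (F : Set (Lit α)) : Set (Lit (UAtom α)) :=
  { l | ∃ a ∈ F, l = Lit.pos (UAtom.aminus a) }

/-- UA : the set of all update atoms for abducibles A. -/
def UAall {α : Type} (A : Set (Lit α)) : Set (Lit (UAtom α)) := pSet A ∪ mSet A

/-- S is a U-minimal answer set of Q (w.r.t. the update atoms UAs). -/
def UMin {β : Type} (Q : Program β) (UAs : Set (Lit β)) (S : Set (Lit β)) : Prop :=
  AnswerSet Q S ∧ ¬ ∃ T, AnswerSet Q T ∧ T ∩ UAs ⊂ S ∩ UAs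

/-- The constraint ← not G. -/
def notCon {α : Type} (G : Lit α) : Rule α := ⟨∅, ∅, {G}⟩

/-- The constraint ← G. -/
def posCon {α : Type} (G : Lit α) : Rule α := ⟨∅, {G}, ∅⟩

/-- r is a non-disjunctive fact  L ← . -/
def isNDFact {α : Type} (r : Rule α) : Prop :=
  (∃ l, r.head = {l}) ∧ r.pbody = ∅ ∧ r.nbody = ∅

/-- R : the abducibles of A that are not non-disjunctive facts. -/
def Rset {α : Type} (A : Program α) : Program α := { r ∈ A | ¬ isNDFact r }

/-- Σ ← Γ, not Δ, γ_R : the rule R with its name γ_R added to the positive body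
(over the atom type α ⊕ Rule α, the name of R being Sum.inr R). -/
noncomputable def addName {α : Type} (r : Rule α) : Rule (α ⊕ Rule α) :=
  letI := Classical.decEq (Lit (α ⊕ Rule α))
  ⟨(Rule.map Sum.inl r).head,
   insert (Lit.pos (Sum.inr r)) (Rule.map Sum.inl r).pbody,
   (Rule.map Sum.inl r).nbody⟩

/-- Pⁿ of the normal form ⟨Pⁿ, Aⁿ⟩ of an abductive program ⟨P, A⟩. -/
noncomputable def Pn {α : Type} (P A : Program α) : Program (α ⊕ Rule α) :=
  (Rule.map Sum.inl '' (P \ Rset A)) ∪ (addName '' Rset A) ∪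
  (facts { l | ∃ r ∈ Rset A ∩ P, l = Lit.pos (Sum.inr r) })

/-- Aⁿ of the normal form ⟨Pⁿ, Aⁿ⟩, as a set of abducible facts (literals). -/
def An {α : Type} (A : Program α) : Set (Lit (α ⊕ Rule α)) :=
  { l | ∃ r ∈ A, isNDFact r ∧ ∃ l₀, r.head = {l₀} ∧ l = Lit.map Sum.inl l₀ } ∪
  { l | ∃ r ∈ Rset A, l = Lit.pos (Sum.inr r) }

/-- The name n(R) of an abducible rule R: itself (embedded) if R is a
non-disjunctive fact, and the fresh atom γ_R otherwise. -/
noncomputable def nLit {α : Type} (r : Rule α) : Lit (α ⊕ Rule α) :=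
  letI := Classical.dec (isNDFact r)
  if h : isNDFact r then Lit.map Sum.inl h.1.choose else Lit.pos (Sum.inr r)

/-- n(E) = { n(R) | R ∈ E }. -/
noncomputable def nSet {α : Type} (E : Program α) : Set (Lit (α ⊕ Rule α)) := nLit '' E

/-- P' accomplishes a view update for the insertion of G (variable rules V). -/
def ViewInsert {α : Type} (P V : Program α) (G : Lit α) (P' : Program α) : Prop :=
  Consistent P' ∧ Entails P' G ∧ P' \ V = P \ V ∧
  ¬ ∃ P'' : Program α, Consistent P'' ∧ Entails P'' G ∧ P'' \ V = P \ V ∧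
      symmDiff (P ∩ V) (P'' ∩ V) ⊂ symmDiff (P ∩ V) (P' ∩ V)

/-- P' accomplishes a view update for the deletion of G (variable rules V). -/
def ViewDelete {α : Type} (P V : Program α) (G : Lit α) (P' : Program α) : Prop :=
  Consistent P' ∧ ¬ Entails P' G ∧ P' \ V = P \ V ∧
  ¬ ∃ P'' : Program α, Consistent P'' ∧ ¬ Entails P'' G ∧ P'' \ V = P \ V ∧
      symmDiff (P ∩ V) (P'' ∩ V) ⊂ symmDiff (P ∩ V) (P' ∩ V)

/-- P' restores consistency (w.r.t. the integrity constraints, variable rules V). -/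
def Restores {α : Type} (P V : Program α) (P' : Program α) : Prop :=
  Consistent P' ∧ P' \ V = P \ V ∧
  ¬ ∃ P'' : Program α, Consistent P'' ∧ P'' \ V = P \ V ∧
      symmDiff (P ∩ V) (P'' ∩ V) ⊂ symmDiff (P ∩ V) (P' ∩ V)

/-- P' accomplishes a theory update of P by Q. -/
def TheoryUpdate {α : Type} (P Q P' : Program α) : Prop :=
  Consistent P' ∧ Q ⊆ P' ∧ P' ⊆ P ∪ Q ∧
  ¬ ∃ P'' : Program α, Consistent P'' ∧ P' ⊂ P'' ∧ P'' ⊆ P ∪ Q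

/-- P' accomplishes the insertion of the rule R to P. -/
def InsertRule {α : Type} (P : Program α) (R : Rule α) (P' : Program α) : Prop :=
  Consistent P' ∧ R ∈ P' ∧ P' ⊆ P ∪ {R} ∧
  ¬ ∃ P'' : Program α, Consistent P'' ∧ P' ⊂ P'' ∧ P'' ⊆ P ∪ {R}

/-- P' accomplishes the deletion of the rule R from P. -/
def DeleteRule {α : Type} (P : Program α) (R : Rule α) (P' : Program α) : Prop :=
  Consistent P' ∧ P' ⊆ P \ {R} ∧
  ¬ ∃ P'' : Program α, Consistent P'' ∧ P' ⊂ P'' ∧ P'' ⊆ P \ {R}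

/-- P' accomplishes an inconsistency removal of P. -/
def InconsRemoval {α : Type} (P P' : Program α) : Prop :=
  Consistent P' ∧ P' ⊆ P ∧
  ¬ ∃ P'' : Program α, Consistent P'' ∧ P' ⊂ P'' ∧ P'' ⊆ P


/-- Adding the constraint `← G` to a program adds exactly the requirement `G ∉ T` to the
conditions on a candidate `T` for the reduct. -/
theorem okNF_reduct_union_posCon {α : Type} (Q : Program α) (G : Lit α) (S T : Set (Lit α)) :
    okNF (reduct (Q ∪ {posCon G}) S) T ↔ okNF (reduct Q S) T ∧ G ∉ T := by
  constructor
  · rintro ⟨hsat, hcompl⟩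
    refine ⟨⟨?_, hcompl⟩, fun hG => ?_⟩
    · rintro r ⟨r₀, hr₀, hn, rfl⟩
      exact hsat _ ⟨r₀, Or.inl hr₀, hn, rfl⟩
    · have hcon := hsat _ ⟨posCon G, Or.inr rfl, by simp [posCon], rfl⟩
      simp [Rule.sat, posCon, hG] at hcon
  · rintro ⟨⟨hsat, hcompl⟩, hG⟩
    refine ⟨?_, hcompl⟩
    rintro r ⟨r₀, hr₀ | rfl, hn, rfl⟩
    · exact hsat _ ⟨r₀, hr₀, hn, rfl⟩
    · simp [Rule.sat, posCon, hG]

/-- The answer sets of `Q ∪ {← G}` are the answer sets of `Q` that do not contain `G`. -/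
theorem answerSet_union_posCon {α : Type} (Q : Program α) (G : Lit α) (S : Set (Lit α)) :
    AnswerSet (Q ∪ {posCon G}) S ↔ AnswerSet Q S ∧ G ∉ S := by
  simp only [AnswerSet, AnswerSetNF, okNF_reduct_union_posCon]
  constructor
  · rintro ⟨⟨hok, hG⟩, hmin⟩
    exact ⟨⟨hok, fun T hTS hT => hmin T hTS ⟨hT, fun h => hG (hTS h)⟩⟩, hG⟩
  · rintro ⟨⟨hok, hmin⟩, hG⟩
    exact ⟨⟨hok, hG⟩, fun T hTS hT => hmin T hTS hT.1⟩

/-- Entailment is refuted exactly by a consistent answer set of `Q ∪ {← G}`. -/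
theorem entails_iff_not_consistent_union_posCon {α : Type} (Q : Program α) (G : Lit α) :
    Entails Q G ↔ ¬ Consistent (Q ∪ {posCon G}) := by
  simp only [Entails, Consistent, ConsAS, answerSet_union_posCon]
  constructor
  · rintro h ⟨S, ⟨hS, hG⟩, -⟩
    exact hG (h S hS)
  · intro h S hS
    by_contra hG
    exact h ⟨S, ⟨hS, hG⟩, fun hu => hG (hu ▸ Set.mem_univ G)⟩

/-- Proposition 3.2 (credulous vs. skeptical explanations): a credulous
explanation (E,F) of G is skeptical iff (P \ F) ∪ E ∪ { ← G } is inconsistent. -/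
theorem credulous_vs_skeptical {α : Type} (P A : Program α) (h1 : AbdAssum1 P A)
    (G : Lit α) (E F : Program α) (hC : CredExpl P A G E F) :
    SkepExpl P A G E F ↔ ¬ Consistent (upd P E F ∪ {posCon G}) := by
  obtain ⟨hHyp, S, hS, -⟩ := hC
  rw [← entails_iff_not_consistent_union_posCon]
  exact ⟨fun h => h.2.2, fun h => ⟨hHyp, ⟨S, hS⟩, h⟩⟩

end ASP
end

section
/- Let P be a program, V the set of variable rules in the language of P, and G a ground literal. Then (P \ F) ∪ E accomplishes a view update for the insertion of G if and only if (E, F) is a minimal skeptical explanation of the positive observation G with respect to the abductive program ⟨P, V⟩. -/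
namespace ASP

theorem upd_diff_variable {α : Type} {P V E F : Program α} (h : Hyp P V E F) :
    upd P E F \ V = P \ V := by
  ext r
  have hE := @h.1 r
  have hF := @h.2 r
  simp only [upd, Set.mem_sdiff, Set.mem_union, Set.mem_inter_iff] at *
  tauto

theorem symmDiff_upd_variable {α : Type} {P V E F : Program α} (h : Hyp P V E F) :
    symmDiff (P ∩ V) (upd P E F ∩ V) = E ∪ F := by
  ext r
  have hE := @h.1 r
  have hF := @h.2 r
  simp only [upd, Set.mem_symmDiff, Set.mem_sdiff, Set.mem_union, Set.mem_inter_iff] at *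
  tauto

/-- Every program agreeing with `P` outside `V` is an update of `P` by variable rules. -/
theorem exists_upd_eq {α : Type} {P V Q : Program α} (h : Q \ V = P \ V) :
    ∃ E F, Hyp P V E F ∧ upd P E F = Q := by
  refine ⟨(Q ∩ V) \ P, (P ∩ V) \ Q, ⟨fun r hr => ⟨hr.1.2, hr.2⟩,
    fun r hr => ⟨hr.1.2, hr.1.1⟩⟩, ?_⟩
  ext r
  have hr := Set.ext_iff.mp h r
  simp only [upd, Set.mem_sdiff, Set.mem_union, Set.mem_inter_iff] at *
  tauto

theorem Hyp.union_subset_union_iff {α : Type} {P V E F E' F' : Program α}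
    (h : Hyp P V E F) (h' : Hyp P V E' F') :
    E' ∪ F' ⊆ E ∪ F ↔ E' ⊆ E ∧ F' ⊆ F := by
  refine ⟨fun hs => ⟨fun r hr => ?_, fun r hr => ?_⟩,
    fun hs => Set.union_subset_union hs.1 hs.2⟩
  · exact (hs (Or.inl hr)).resolve_right fun hF => (h'.1 hr).2 (h.2 hF).2
  · exact (hs (Or.inr hr)).resolve_left fun hE => (h.1 hE).2 (h'.2 hr).2

/-- Theorem 4.1, insertion part (view updates by extended abduction). -/
theorem view_insertion_by_extended_abduction {α : Type} (P V : Program α)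
    (h1 : AbdAssum1 P V) (h2 : AbdAssum2 P V) (G : Lit α)
    (E F : Program α) (hE : E ⊆ V \ P) (hF : F ⊆ V ∩ P) :
    ViewInsert P V G (upd P E F) ↔ MinimalPair (SkepExpl P V G) E F := by
  have h : Hyp P V E F := ⟨hE, hF⟩
  constructor
  · rintro ⟨hc, hG, -, hmin⟩
    refine ⟨⟨h, hc, hG⟩, fun E' F' ⟨h', hc', hG'⟩ hEE hFF => ?_⟩
    have hs : E ∪ F ⊆ E' ∪ F' := by
      by_contra hs
      refine hmin ⟨upd P E' F', hc', hG', upd_diff_variable h', ?_⟩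
      rw [symmDiff_upd_variable h, symmDiff_upd_variable h']
      exact ⟨Set.union_subset_union hEE hFF, hs⟩
    obtain ⟨hEE', hFF'⟩ := (h'.union_subset_union_iff h).mp hs
    exact ⟨hEE.antisymm hEE', hFF.antisymm hFF'⟩
  · rintro ⟨⟨-, hc, hG⟩, hmin⟩
    refine ⟨hc, hG, upd_diff_variable h, ?_⟩
    rintro ⟨Q, hcQ, hGQ, hQ, hlt⟩
    obtain ⟨E', F', h', rfl⟩ := exists_upd_eq hQ
    rw [symmDiff_upd_variable h, symmDiff_upd_variable h'] at hlt
    obtain ⟨hEE, hFF⟩ := (h.union_subset_union_iff h').mp hlt.1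
    obtain ⟨rfl, rfl⟩ := hmin E' F' ⟨h', hcQ, hGQ⟩ hEE hFF
    exact hlt.2 subset_rfl

end ASP
end

section
/- Let P be a program and R = (Σ ← Γ, not Δ) a rule in P, and let γ_R be a fresh atom not occurring in P. Define PR = (P \ {R}) ∪ { Σ ← Γ, not Δ, γ_R } ∪ { γ_R ← }. Then there exists a program P' which accomplishes the deletion of R from P if and only if there exists a program PR' which accomplishes the insertion of the integrity constraint ← γ_R to PR. -/
namespace ASP

/-- The rule R with the fresh atom γ added to its positive body. -/
noncomputable def addGamma {α : Type} (γ : α) (r : Rule α) : Rule α :=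
  letI := Classical.decEq (Lit α)
  ⟨r.head, insert (Lit.pos γ) r.pbody, r.nbody⟩

theorem okNF_reduct_iff {α : Type} {P : Program α} {S T : Set (Lit α)} :
    okNF (reduct P S) T ↔
      (∀ r ∈ P, (∀ l ∈ r.nbody, l ∉ S) → (∀ l ∈ r.pbody, l ∈ T) → ∃ l ∈ r.head, l ∈ T) ∧
        ((∃ l : Lit α, l ∈ T ∧ l.compl ∈ T) → T = Set.univ) := by
  refine and_congr_left' ⟨fun h r hr hn hp => ?_, ?_⟩
  · exact h ⟨r.head, r.pbody, ∅⟩ ⟨r, hr, hn, rfl⟩ ⟨hp, by simp⟩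
  · rintro h _ ⟨r, hr, hn, rfl⟩ ⟨hp, -⟩
    exact h r hr hn hp

theorem okNF_reduct_mono {α : Type} {P Q : Program α} (h : Q ⊆ P) {S T : Set (Lit α)}
    (hT : okNF (reduct P S) T) : okNF (reduct Q S) T := by
  rw [okNF_reduct_iff] at *
  exact ⟨fun r hr => hT.1 r (h hr), hT.2⟩

theorem pos_notMem_of_fresh {α : Type} {r : Rule α} {γ : α} (h : γ ∉ r.atoms) :
    Lit.pos γ ∉ r.head ∧ Lit.pos γ ∉ r.pbody := by
  constructor <;> intro hm <;> exact h ⟨Lit.pos γ, by simp [hm], rfl⟩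

theorem notMem_of_posCon_mem {α : Type} {X : Program α} {S T : Set (Lit α)} {l : Lit α}
    (hX : posCon l ∈ X) (hT : okNF (reduct X S) T) : l ∉ T := by
  intro hl
  obtain ⟨k, hk, -⟩ := (okNF_reduct_iff.1 hT).1 _ hX (by simp [posCon])
    (by simpa [posCon] using hl)
  simp [posCon] at hk

/-- A consistent answer set contains no fresh atom. -/
theorem ConsAS.pos_notMem {α : Type} {Q : Program α} {S : Set (Lit α)} {γ : α}
    (hS : ConsAS Q S) (hγ : ∀ r ∈ Q, γ ∉ r.atoms) : Lit.pos γ ∉ S := by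
  obtain ⟨⟨hok, hmin⟩, hne⟩ := hS
  rw [okNF_reduct_iff] at hok
  have hT : S \ {Lit.pos γ} = S := by
    refine hmin _ Set.sdiff_subset (okNF_reduct_iff.2 ⟨fun r hr hn hp => ?_, ?_⟩)
    · obtain ⟨l, hl, hlS⟩ := hok.1 r hr hn fun l hl => (hp l hl).1
      refine ⟨l, hl, hlS, ?_⟩
      rintro rfl
      exact (pos_notMem_of_fresh (hγ r hr)).1 hl
    · rintro ⟨l, hl, hl'⟩
      exact absurd (hok.2 ⟨l, hl.1, hl'.1⟩) hne
  intro hmem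
  rw [← hT] at hmem
  exact hmem.2 rfl

/-- Rules blocked by a forbidden fresh atom do not affect consistency. -/
theorem consistent_union_iff {α : Type} {Q Y : Program α} {γ : α}
    (hQ : ∀ r ∈ Q, γ ∉ r.atoms) (hY : ∀ r ∈ Y, Lit.pos γ ∈ r.pbody)
    (hc : posCon (Lit.pos γ) ∈ Y) : Consistent (Q ∪ Y) ↔ Consistent Q := by
  have key : ∀ S T : Set (Lit α), Lit.pos γ ∉ T → okNF (reduct Q S) T →
      okNF (reduct (Q ∪ Y) S) T := by
    intro S T hT hok
    rw [okNF_reduct_iff] at *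
    refine ⟨?_, hok.2⟩
    rintro r (hr | hr) hn hp
    · exact hok.1 r hr hn hp
    · exact absurd (hp _ (hY r hr)) hT
  constructor
  · rintro ⟨S, ⟨hok, hmin⟩, hne⟩
    have hS := notMem_of_posCon_mem (Or.inr hc) hok
    exact ⟨S, ⟨okNF_reduct_mono Set.subset_union_left hok, fun T hTS hT =>
      hmin T hTS (key S T (fun h => hS (hTS h)) hT)⟩, hne⟩
  · rintro ⟨S, hS⟩
    exact ⟨S, ⟨key S S (hS.pos_notMem hQ) hS.1.1, fun T hTS hT =>
      hS.1.2 T hTS (okNF_reduct_mono Set.subset_union_left hT)⟩, hS.2⟩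

theorem not_consistent_of_factOf_of_posCon {α : Type} {X : Program α} {l : Lit α}
    (hf : factOf l ∈ X) (hc : posCon l ∈ X) : ¬ Consistent X := by
  rintro ⟨S, ⟨hok, -⟩, -⟩
  refine notMem_of_posCon_mem hc hok ?_
  obtain ⟨k, hk, hkS⟩ := (okNF_reduct_iff.1 hok).1 _ hf (by simp [factOf]) (by simp [factOf])
  simp only [factOf, Finset.mem_singleton] at hk
  exact hk ▸ hkS

/-- Proposition 5.1 (converting deletion of a rule to insertion of a rule). -/
theorem deletion_to_insertion {α : Type} (P : Program α) (R : Rule α) (hR : R ∈ P)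
    (γ : α) (hγ : ∀ r ∈ P, γ ∉ r.atoms) :
    (∃ P', DeleteRule P R P') ↔
      (∃ PR', InsertRule ((P \ {R}) ∪ ({addGamma γ R} : Program α) ∪
          ({factOf (Lit.pos γ)} : Program α)) (posCon (Lit.pos γ)) PR') := by
  have hB : ∀ r ∈ P \ {R}, γ ∉ r.atoms := fun r hr => hγ r hr.1
  have hblocked : ∀ r ∈ ({addGamma γ R, posCon (Lit.pos γ)} : Program α),
      Lit.pos γ ∈ r.pbody := by
    rintro r (rfl | rfl) <;> simp [addGamma, posCon]
  have hrest : ∀ X : Program α, Consistent X → posCon (Lit.pos γ) ∈ X →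
      X ⊆ P \ {R} ∪ {addGamma γ R} ∪ {factOf (Lit.pos γ)} ∪ {posCon (Lit.pos γ)} →
      ∀ r ∈ X, r ∉ P \ {R} → r ∈ ({addGamma γ R, posCon (Lit.pos γ)} : Program α) := by
    intro X hX hc hsub r hr hrB
    rcases hsub hr with ((h | h) | h) | h
    · exact absurd h hrB
    · exact Or.inl h
    · rw [Set.mem_singleton_iff] at h
      subst h
      exact absurd hX (not_consistent_of_factOf_of_posCon hr hc)
    · exact Or.inr h
  have hcB : posCon (Lit.pos γ) ∉ P \ {R} := fun h =>
    (pos_notMem_of_fresh (hB _ h)).2 (by simp [posCon])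
  have hsplit : ∀ X : Program α, Consistent X → posCon (Lit.pos γ) ∈ X →
      X ⊆ P \ {R} ∪ {addGamma γ R} ∪ {factOf (Lit.pos γ)} ∪ {posCon (Lit.pos γ)} →
      Consistent (X ∩ (P \ {R})) := by
    intro X hX hc hsub
    rw [← consistent_union_iff (Y := X \ (P \ {R})) (γ := γ) (fun r hr => hB r hr.2)
      (fun r hr => hblocked r (hrest X hX hc hsub r hr.1 hr.2)) ⟨hc, hcB⟩,
      Set.inter_union_sdiff]
    exact hX
  constructor
  · rintro ⟨Q, hQ, hQB, hmax⟩
    refine ⟨Q ∪ {addGamma γ R, posCon (Lit.pos γ)},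
      (consistent_union_iff (fun r hr => hB r (hQB hr)) hblocked (by simp)).2 hQ,
      by simp, ?_, ?_⟩
    · rintro r (hr | rfl | rfl)
      · exact Or.inl (Or.inl (Or.inl (hQB hr)))
      · simp
      · simp
    · rintro ⟨X, hX, hss, hsub⟩
      have hc : posCon (Lit.pos γ) ∈ X := hss.1 (by simp)
      obtain ⟨r, hrX, hr⟩ := Set.exists_of_ssubset hss
      have hrB : r ∈ P \ {R} := by
        by_contra h
        exact hr (Or.inr (hrest X hX hc hsub r hrX h))
      exact hmax ⟨_, hsplit X hX hc hsub,
        ⟨fun q hq => ⟨hss.1 (Or.inl hq), hQB hq⟩, fun h => hr (Or.inl (h ⟨hrX, hrB⟩))⟩,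
        Set.inter_subset_right⟩
  · rintro ⟨X, hX, hc, hsub, hmax⟩
    refine ⟨X ∩ (P \ {R}), hsplit X hX hc hsub, Set.inter_subset_right, ?_⟩
    rintro ⟨Q, hQ, hss, hQB⟩
    obtain ⟨r, hrQ, hr⟩ := Set.exists_of_ssubset hss
    refine hmax ⟨Q ∪ X \ (P \ {R}), (consistent_union_iff (Y := X \ (P \ {R})) (fun r hr => hB r (hQB hr))
      (fun r hr => hblocked r (hrest X hX hc hsub r hr.1 hr.2)) ⟨hc, hcB⟩).2 hQ,
      ⟨fun q hq => ?_, fun h => hr ⟨h (Or.inl hrQ), hQB hrQ⟩⟩, ?_⟩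
    · by_cases hqB : q ∈ P \ {R}
      · exact Or.inl (hss.1 ⟨hq, hqB⟩)
      · exact Or.inr ⟨hq, hqB⟩
    · rintro q (hq | hq)
      · exact Or.inl (Or.inl (Or.inl (hQB hq)))
      · exact hsub hq.1

end ASP
end

section
/- Let P and Q be programs. Then a program P' accomplishes a theory update of P by Q if and only if P' = (P ∪ Q) \ F where (∅, F) is a minimal credulous anti-explanation of the negative observation G = ⊥ with respect to the abductive program ⟨P ∪ Q, P \ Q⟩. -/
namespace ASP

theorem credAntiExplBot_empty_iff {α : Type} (P Q F : Program α) :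
    CredAntiExplBot (P ∪ Q) (P \ Q) ∅ F ↔ F ⊆ P \ Q ∧ Consistent ((P ∪ Q) \ F) := by
  have hA : (P \ Q) ∩ (P ∪ Q) = P \ Q :=
    Set.inter_eq_left.mpr (Set.sdiff_subset.trans Set.subset_union_left)
  simp only [CredAntiExplBot, Hyp, upd, Set.union_empty, Set.empty_subset, true_and, hA]

/-- Theorem 5.2 (theory updates by extended abduction). -/
theorem theory_updates_by_extended_abduction {α : Type} (P Q P' : Program α) :
    TheoryUpdate P Q P' ↔
      ∃ F : Program α, P' = (P ∪ Q) \ F ∧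
        MinimalPair (CredAntiExplBot (P ∪ Q) (P \ Q)) ∅ F := by
  constructor
  · rintro ⟨hcons, hQ, hsub, hmax⟩
    have hP' : (P ∪ Q) \ ((P ∪ Q) \ P') = P' := Set.sdiff_sdiff_cancel_left hsub
    refine ⟨(P ∪ Q) \ P', hP'.symm, ?_, ?_⟩
    · rw [credAntiExplBot_empty_iff, hP']
      exact ⟨fun r hr => ⟨hr.1.resolve_right fun h => hr.2 (hQ h), fun h => hr.2 (hQ h)⟩, hcons⟩
    · intro E F' hX hE hF
      obtain rfl := Set.subset_empty_iff.mp hE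
      refine ⟨rfl, hF.antisymm fun r hr => ?_⟩
      by_contra hrF
      refine hmax ⟨(P ∪ Q) \ F', ((credAntiExplBot_empty_iff P Q F').mp hX).2, ?_,
        Set.sdiff_subset⟩
      exact ⟨fun x hx => ⟨hsub hx, fun h => (hF h).2 hx⟩, fun h => hr.2 (h ⟨hr.1, hrF⟩)⟩
  · rintro ⟨F, rfl, hX, hmin⟩
    obtain ⟨hF, hcons⟩ := (credAntiExplBot_empty_iff P Q F).mp hX
    refine ⟨hcons, fun r hr => ⟨Or.inr hr, fun h => (hF h).2 hr⟩, Set.sdiff_subset, ?_⟩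
    rintro ⟨P'', hcons', hlt, hsub⟩
    have hle : (P ∪ Q) \ P'' ⊆ F := fun r hr => by
      by_contra h
      exact hr.2 (hlt.1 ⟨hr.1, h⟩)
    have hX' : CredAntiExplBot (P ∪ Q) (P \ Q) ∅ ((P ∪ Q) \ P'') := by
      rw [credAntiExplBot_empty_iff, Set.sdiff_sdiff_cancel_left hsub]
      exact ⟨hle.trans hF, hcons'⟩
    obtain ⟨-, rfl⟩ := hmin _ _ hX' subset_rfl hle
    exact hlt.2 (Set.sdiff_sdiff_cancel_left hsub).ge

end ASP
end
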